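/- (Upscale error bound via the LP constraints.) Let 0 < ε < ε', and for each l ∈ ℕ let l'(l) = ⌊log_{1+2ε'²}(1 + 2ε'²·A_ε(l)/(1 + ε'²))⌋ and p_l = (A_ε(l) − A_{ε'}(l'(l)))/(A_{ε'}(l'(l)+1) − A_{ε'}(l'(l))). Suppose α ≥ 0 and β ≥ 0 satisfy, for every l ∈ ℕ, (A_{ε'}(l'(l)+1) − A_ε(l))·(A_ε(l) − A_{ε'}(l'(l))) ≤ α·A_ε(l)² + β·A_ε(l). Then for every integer n ≥ 1, the mean square relative error after upscaling at time n satisfies (1/n²)·Σ_{l ∈ ℕ} Q_l(n)·[p_l·(A_{ε'}(l'(l)+1) − n)² + (1 − p_l)·(A_{ε'}(l'(l)) − n)²] ≤ ε² + α(1 + ε²) + β. -/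

import Mathlib

/-- The optimal estimation function (on integer symbols, agreeing with the
usual definition on ℕ): `A_ε(l) = ((1+2ε²)^l − 1)(1+ε²)/(2ε²)`. -/
noncomputable def A (ε : ℝ) (l : ℤ) : ℝ :=
  ((1 + 2 * ε ^ 2) ^ l - 1) / (2 * ε ^ 2) * (1 + ε ^ 2)

/-- `D_ε(l) = A_ε(l+1) − A_ε(l)`. -/
noncomputable def D (ε : ℝ) (l : ℤ) : ℝ := A ε (l + 1) - A ε l

/-- `Q ε n l` is the probability `Q_l(n)` that the counter's symbol equals `l`
after `n` packet arrivals, for the process that starts at symbol `0` and on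
each arrival increments the current symbol `l` to `l+1` with probability
`1/D_ε(l)`. -/
noncomputable def Q (ε : ℝ) : ℕ → ℕ → ℝ
  | 0, 0 => 1
  | 0, _ + 1 => 0
  | n + 1, 0 => Q ε n 0 * (1 - 1 / D ε 0)
  | n + 1, l + 1 =>
      Q ε n (l + 1) * (1 - 1 / D ε ((l : ℤ) + 1)) + Q ε n l / D ε (l : ℤ)

theorem D_eq {ε : ℝ} (hε : ε ≠ 0) (l : ℤ) : D ε l = 1 + ε ^ 2 + 2 * ε ^ 2 * A ε l := by
  have h : (1 + 2 * ε ^ 2 : ℝ) ≠ 0 := by positivity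
  unfold D A
  rw [zpow_add_one₀ h]
  field_simp
  ring

theorem D_eq_zpow {ε : ℝ} (hε : ε ≠ 0) (l : ℤ) :
    D ε l = (1 + 2 * ε ^ 2) ^ l * (1 + ε ^ 2) := by
  rw [D_eq hε]
  unfold A
  field_simp
  ring

theorem D_pos {ε : ℝ} (hε : ε ≠ 0) (l : ℤ) : 0 < D ε l := by
  rw [D_eq_zpow hε]
  positivity

theorem one_le_D {ε : ℝ} (hε : ε ≠ 0) (l : ℕ) : 1 ≤ D ε (l : ℤ) := by
  rw [D_eq_zpow hε, zpow_natCast]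
  have h : (1 : ℝ) ≤ (1 + 2 * ε ^ 2) ^ l := one_le_pow₀ (by nlinarith [sq_nonneg ε])
  nlinarith [sq_nonneg ε]

theorem A_zero (ε : ℝ) : A ε 0 = 0 := by
  simp [A]

theorem Q_nonneg {ε : ℝ} (hε : ε ≠ 0) (n l : ℕ) : 0 ≤ Q ε n l := by
  have stay : ∀ m : ℕ, 0 ≤ 1 - 1 / D ε (m : ℤ) := fun m ↦
    sub_nonneg.2 ((div_le_one (D_pos hε _)).2 (one_le_D hε m))
  induction n generalizing l with
  | zero => cases l <;> simp [Q]
  | succ n ih =>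
    cases l with
    | zero =>
      rw [Q]
      exact mul_nonneg (ih 0) (by simpa using stay 0)
    | succ l =>
      rw [Q]
      exact add_nonneg (mul_nonneg (ih _) (by simpa using stay (l + 1)))
        (div_nonneg (ih l) (D_pos hε _).le)

theorem Q_eq_zero_of_lt (ε : ℝ) {n l : ℕ} (h : n < l) : Q ε n l = 0 := by
  induction n generalizing l with
  | zero =>
    cases l with
    | zero => omega
    | succ l => simp [Q]
  | succ n ih =>
    cases l with
    | zero => omega
    | succ l => rw [Q, ih (by omega), ih (by omega)]; simp

/-- The expectation of a function of the symbol after `n` arrivals. -/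
noncomputable def expectQ (ε : ℝ) (n : ℕ) (f : ℕ → ℝ) : ℝ :=
  ∑ l ∈ Finset.range (n + 1), Q ε n l * f l

theorem tsum_Q_mul (ε : ℝ) (n : ℕ) (f : ℕ → ℝ) : ∑' l, Q ε n l * f l = expectQ ε n f := by
  refine tsum_eq_sum fun l hl ↦ ?_
  rw [Q_eq_zero_of_lt ε (by rw [Finset.mem_range] at hl; omega), zero_mul]

theorem expectQ_mono {ε : ℝ} (hε : ε ≠ 0) (n : ℕ) {f g : ℕ → ℝ} (h : ∀ l, f l ≤ g l) :
    expectQ ε n f ≤ expectQ ε n g :=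
  Finset.sum_le_sum fun l _ ↦ mul_le_mul_of_nonneg_left (h l) (Q_nonneg hε n l)

theorem expectQ_add (ε : ℝ) (n : ℕ) (f g : ℕ → ℝ) :
    expectQ ε n (fun l ↦ f l + g l) = expectQ ε n f + expectQ ε n g := by
  simp only [expectQ, mul_add, Finset.sum_add_distrib]

theorem expectQ_const_mul (ε : ℝ) (n : ℕ) (c : ℝ) (f : ℕ → ℝ) :
    expectQ ε n (fun l ↦ c * f l) = c * expectQ ε n f := by
  simp only [expectQ, Finset.mul_sum]
  exact Finset.sum_congr rfl fun l _ ↦ by ring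

theorem expectQ_succ (ε : ℝ) (n : ℕ) (f : ℕ → ℝ) :
    expectQ ε (n + 1) f =
      expectQ ε n f + expectQ ε n (fun l ↦ (f (l + 1) - f l) / D ε (l : ℤ)) := by
  have stay : ∑ l ∈ Finset.range (n + 1),
        Q ε n (l + 1) * (1 - 1 / D ε ((l : ℤ) + 1)) * f (l + 1) +
        Q ε n 0 * (1 - 1 / D ε 0) * f 0 =
      ∑ l ∈ Finset.range (n + 1), Q ε n l * (1 - 1 / D ε (l : ℤ)) * f l := by
    have h := Finset.sum_range_succ' (fun l : ℕ ↦ Q ε n l * (1 - 1 / D ε (l : ℤ)) * f l) (n + 1)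
    rw [Finset.sum_range_succ, Q_eq_zero_of_lt ε (Nat.lt_succ_self n)] at h
    push_cast at h
    linarith
  simp only [expectQ]
  rw [Finset.sum_range_succ']
  simp only [Q, add_mul, Finset.sum_add_distrib]
  rw [add_right_comm, stay, ← Finset.sum_add_distrib, ← Finset.sum_add_distrib]
  exact Finset.sum_congr rfl fun l _ ↦ by ring

theorem expectQ_one (ε : ℝ) (n : ℕ) : expectQ ε n (fun _ ↦ 1) = 1 := by
  induction n with
  | zero => simp [expectQ, Q]
  | succ n ih => rw [expectQ_succ, ih]; simp [expectQ]

theorem expectQ_A {ε : ℝ} (hε : ε ≠ 0) (n : ℕ) : expectQ ε n (fun l ↦ A ε (l : ℤ)) = n := by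
  induction n with
  | zero => simp [expectQ, A_zero]
  | succ n ih =>
    have h : (fun l : ℕ ↦ (A ε ((l + 1 : ℕ) : ℤ) - A ε (l : ℤ)) / D ε (l : ℤ)) = fun _ ↦ 1 := by
      funext l
      push_cast
      exact div_self (D_pos hε l).ne'
    rw [expectQ_succ, ih, h, expectQ_one]
    push_cast
    ring

theorem expectQ_A_sq {ε : ℝ} (hε : ε ≠ 0) (n : ℕ) :
    expectQ ε n (fun l ↦ A ε (l : ℤ) ^ 2) = (1 + ε ^ 2) * (n : ℝ) ^ 2 := by
  induction n with
  | zero => simp [expectQ, A_zero]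
  | succ n ih =>
    have h : (fun l : ℕ ↦ (A ε ((l + 1 : ℕ) : ℤ) ^ 2 - A ε (l : ℤ) ^ 2) / D ε (l : ℤ)) =
        fun l : ℕ ↦ 2 * (1 + ε ^ 2) * A ε (l : ℤ) + (1 + ε ^ 2) * 1 := by
      funext l
      have hD := D_eq hε l
      have hA : A ε ((l : ℤ) + 1) = A ε l + D ε l := by rw [D]; ring
      rw [div_eq_iff (D_pos hε l).ne']
      push_cast
      rw [hA]
      linear_combination D ε l * hD
    rw [expectQ_succ, ih, h, expectQ_add, expectQ_const_mul, expectQ_const_mul, expectQ_A hε,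
      expectQ_one]
    push_cast
    ring

/-- Randomized rounding of `a` to the endpoints of `[x, y]` preserves the mean, so the mean square
error splits into the original error and the rounding variance. -/
theorem rounding_sq_error {x y : ℝ} (hxy : y - x ≠ 0) (a m : ℝ) :
    (a - x) / (y - x) * (y - m) ^ 2 + (1 - (a - x) / (y - x)) * (x - m) ^ 2 =
      (a - m) ^ 2 + (y - a) * (a - x) := by
  field_simp
  ring

/-- Upscale error bound via the LP constraints: let
`0 < ε < ε'`, let `l'(l)` be the upscaled symbol and `p_l` the rounding
probability of the symbol-upscale procedure, and suppose `α, β ≥ 0` satisfy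
`(A_{ε'}(l'(l)+1) − A_ε(l))·(A_ε(l) − A_{ε'}(l'(l))) ≤ α·A_ε(l)² + β·A_ε(l)`
for every `l`. Then for every `n ≥ 1` the mean square relative error after
upscaling at time `n` is at most `ε² + α(1 + ε²) + β`. -/
theorem upscale_error_bound (ε ε' : ℝ) (hε : 0 < ε) (hεε' : ε < ε')
    (l' : ℕ → ℤ)
    (hl' : ∀ l : ℕ, l' l = ⌊Real.logb (1 + 2 * ε' ^ 2)
      (1 + 2 * ε' ^ 2 * A ε (l : ℤ) / (1 + ε' ^ 2))⌋)
    (p : ℕ → ℝ)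
    (hp : ∀ l : ℕ, p l =
      (A ε (l : ℤ) - A ε' (l' l)) / (A ε' (l' l + 1) - A ε' (l' l)))
    (α β : ℝ) (hα : 0 ≤ α) (hβ : 0 ≤ β)
    (hcon : ∀ l : ℕ,
      (A ε' (l' l + 1) - A ε (l : ℤ)) * (A ε (l : ℤ) - A ε' (l' l)) ≤
        α * (A ε (l : ℤ)) ^ 2 + β * A ε (l : ℤ))
    (n : ℕ) (hn : 1 ≤ n) :
    (1 / (n : ℝ) ^ 2) *
      (∑' l : ℕ, Q ε n l *
        (p l * (A ε' (l' l + 1) - (n : ℝ)) ^ 2 +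
          (1 - p l) * (A ε' (l' l) - (n : ℝ)) ^ 2)) ≤
      ε ^ 2 + α * (1 + ε ^ 2) + β := by
  have hε0 : ε ≠ 0 := hε.ne'
  have hε'0 : ε' ≠ 0 := (hε.trans hεε').ne'
  have hn1 : (1 : ℝ) ≤ n := by exact_mod_cast hn
  have bound : ∀ l : ℕ, p l * (A ε' (l' l + 1) - (n : ℝ)) ^ 2 +
      (1 - p l) * (A ε' (l' l) - (n : ℝ)) ^ 2 ≤
      (1 + α) * A ε (l : ℤ) ^ 2 + ((β - 2 * n) * A ε (l : ℤ) + (n : ℝ) ^ 2 * 1) := fun l ↦ by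
    rw [hp l, rounding_sq_error (D_pos hε'0 (l' l)).ne']
    linarith [hcon l]
  rw [tsum_Q_mul, one_div_mul_eq_div, div_le_iff₀ (by positivity)]
  refine (expectQ_mono hε0 n bound).trans ?_
  rw [expectQ_add, expectQ_add, expectQ_const_mul, expectQ_const_mul, expectQ_const_mul,
    expectQ_A_sq hε0, expectQ_A hε0, expectQ_one]
  have hβn : β * n ≤ β * (n : ℝ) ^ 2 := mul_le_mul_of_nonneg_left (by nlinarith) hβ
  linarith
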